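/- Let w ∈ [m]^n with gcd(m,n) = d > 1, and suppose w is an (m,n)-parking word having at least one touch point. Then the action of w on V^m has infinitely many fixed points; in fact, Fix(w) contains points of arbitrarily large norm. -/

import Mathlib

def IsParkingWord (m n : ℕ) (p : Fin n → ℕ) : Prop :=
  (∀ j, p j < m) ∧
  ∀ i : ℕ, 1 ≤ i → i ≤ m →
    i * n ≤ m * (Finset.univ.filter (fun j => p j < i)).card

noncomputable def sortTuple {m : ℕ} (x : Fin m → ℝ) : Fin m → ℝ :=
  x ∘ Tuple.sort x

noncomputable def letterAct (m : ℕ) (i : Fin m) (x : Fin m → ℝ) : Fin m → ℝ :=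
  sortTuple (fun j => x j + (if j = i then (m : ℝ) else 0) - 1)

noncomputable def wordAct {m n : ℕ} (w : Fin n → Fin m) (x : Fin m → ℝ) : Fin m → ℝ :=
  (List.ofFn w).foldl (fun y i => letterAct m i y) x

def Vm (m : ℕ) : Set (Fin m → ℝ) :=
  {x | (∑ j, x j) = 0 ∧ Monotone x}

def normSq {m : ℕ} (x : Fin m → ℝ) : ℝ :=
  ∑ i, ∑ j, if i < j then (x j - x i) ^ 2 else 0

/-- An index `1 ≤ i < m` is a touch point of `p` when `|{j : p j < i}| = i·n/m`. -/
def IsTouchPoint (m n : ℕ) (p : Fin n → ℕ) (i : ℕ) : Prop :=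
  1 ≤ i ∧ i < m ∧ m * (Finset.univ.filter (fun j => p j < i)).card = i * n

/-- The sum of the coordinates of `x` whose index is less than `j`. -/
def initialSum {m : ℕ} (j : ℕ) (x : Fin m → ℝ) : ℝ :=
  ∑ a : Fin m, if (a : ℕ) < j then x a else 0

section Sorting

variable {m : ℕ}

lemma sortTuple_monotone (x : Fin m → ℝ) : Monotone (sortTuple x) :=
  Tuple.monotone_sort x

lemma sortTuple_eq_self {x : Fin m → ℝ} (hx : Monotone x) : sortTuple x = x := by
  have h := Tuple.sort_eq_refl_iff_monotone.mpr hx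
  simp [sortTuple, h]

lemma sum_comp_sortTuple (g : ℝ → ℝ) (x : Fin m → ℝ) :
    ∑ a, g (sortTuple x a) = ∑ a, g (x a) :=
  Equiv.sum_comp (Tuple.sort x) (fun a => g (x a))

lemma sortTuple_le_add {x y : Fin m → ℝ} {c : ℝ} (h : ∀ a, x a ≤ y a + c) (a : Fin m) :
    sortTuple x a ≤ sortTuple y a + c := by
  by_contra! hlt
  have hsub : (Finset.Iic a).image (Tuple.sort y) ⊆
      (Finset.univ.filter fun b => sortTuple x b < sortTuple x a).image (Tuple.sort x) := by
    intro b hb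
    simp only [Finset.mem_image, Finset.mem_univ, true_and,
      Finset.mem_Iic, Finset.mem_filter] at hb ⊢
    obtain ⟨d, hd, rfl⟩ := hb
    refine ⟨(Tuple.sort x).symm (Tuple.sort y d), ?_, by simp⟩
    have h1 : sortTuple y d ≤ sortTuple y a := sortTuple_monotone y hd
    have h2 := h (Tuple.sort y d)
    simp only [sortTuple, Function.comp_apply, Equiv.apply_symm_apply] at *
    linarith
  have hcard := Finset.card_le_card hsub
  rw [Finset.card_image_of_injective _ (Tuple.sort y).injective,
    Finset.card_image_of_injective _ (Tuple.sort x).injective] at hcard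
  have hlt' : (Finset.univ.filter fun b => sortTuple x b < sortTuple x a) ⊆ Finset.Iio a := by
    intro b hb
    simp only [Finset.mem_filter, Finset.mem_univ, true_and, Finset.mem_Iio] at hb ⊢
    exact (sortTuple_monotone x).reflect_lt hb
  have hcard' := Finset.card_le_card hlt'
  simp at hcard hcard'
  omega

lemma sum_ite_val_lt {j : ℕ} (hj : j ≤ m) (c : ℝ) :
    (∑ a : Fin m, if (a : ℕ) < j then c else 0) = j * c := by
  rw [Fin.sum_univ_eq_sum_range (fun a => if a < j then c else 0) m, ← Finset.sum_filter]
  have : (Finset.range m).filter (fun a => a < j) = Finset.range j := by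
    ext a; simp; omega
  rw [this]; simp

lemma sum_min_le_initialSum {j : ℕ} (hj : j ≤ m) (c : ℝ) (x : Fin m → ℝ) :
    j * c + ∑ a, min (x a - c) 0 ≤ initialSum j x := by
  rw [← sum_ite_val_lt hj c, initialSum, ← Finset.sum_add_distrib]
  refine Finset.sum_le_sum fun a _ => ?_
  split_ifs
  · linarith [min_le_left (x a - c) 0]
  · linarith [min_le_right (x a - c) 0]

lemma initialSum_eq_sum_min {j : ℕ} (hj : j ≤ m) {c : ℝ} {x : Fin m → ℝ}
    (hlow : ∀ a : Fin m, (a : ℕ) < j → x a ≤ c) (hhigh : ∀ a : Fin m, j ≤ (a : ℕ) → c ≤ x a) :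
    initialSum j x = j * c + ∑ a, min (x a - c) 0 := by
  rw [← sum_ite_val_lt hj c, initialSum, ← Finset.sum_add_distrib]
  refine Finset.sum_congr rfl fun a _ => ?_
  split_ifs with h
  · rw [min_eq_left (by linarith [hlow a h])]; ring
  · rw [min_eq_right (by linarith [hhigh a (by omega)])]; ring

lemma initialSum_sortTuple_le {j : ℕ} (hj : j ≤ m) (hj0 : 1 ≤ j) (x : Fin m → ℝ) :
    initialSum j (sortTuple x) ≤ initialSum j x := by
  have hmono := sortTuple_monotone x
  rw [initialSum_eq_sum_min hj (c := sortTuple x ⟨j - 1, by omega⟩)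
    (fun a ha => hmono (Fin.mk_le_mk.mpr (by omega)))
    (fun a ha => hmono (Fin.mk_le_mk.mpr (by omega))),
    sum_comp_sortTuple (fun r => min (r - _) 0)]
  exact sum_min_le_initialSum hj _ x

lemma initialSum_le_sortTuple {j : ℕ} (hj : j ≤ m) {c : ℝ} {x : Fin m → ℝ}
    (hlow : ∀ a : Fin m, (a : ℕ) < j → x a ≤ c) (hhigh : ∀ a : Fin m, j ≤ (a : ℕ) → c ≤ x a) :
    initialSum j x ≤ initialSum j (sortTuple x) := by
  rw [initialSum_eq_sum_min hj hlow hhigh, ← sum_comp_sortTuple (fun r => min (r - c) 0)]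
  exact sum_min_le_initialSum hj c _

lemma sortTuple_le_of_low {j : ℕ} (hj : j ≤ m) {c : ℝ} {x : Fin m → ℝ}
    (hlow : ∀ a : Fin m, (a : ℕ) < j → x a ≤ c) (a : Fin m) (ha : (a : ℕ) < j) :
    sortTuple x a ≤ c := by
  by_contra! hlt
  have hsub : Finset.univ.image (Fin.castLE hj) ⊆
      (Finset.Iio a).image (Tuple.sort x) := by
    intro b hb
    simp only [Finset.mem_image, Finset.mem_univ, true_and, Finset.mem_Iio] at hb ⊢
    obtain ⟨d, rfl⟩ := hb
    refine ⟨(Tuple.sort x).symm (Fin.castLE hj d), ?_, by simp⟩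
    apply (sortTuple_monotone x).reflect_lt
    have := hlow (Fin.castLE hj d) (by simp)
    simp only [sortTuple, Function.comp_apply, Equiv.apply_symm_apply] at *
    linarith
  have hcard := Finset.card_le_card hsub
  rw [Finset.card_image_of_injective _ (Fin.castLE_injective hj),
    Finset.card_image_of_injective _ (Tuple.sort x).injective] at hcard
  simp at hcard
  omega

lemma le_sortTuple_of_high {j : ℕ} {c : ℝ} {x : Fin m → ℝ}
    (hhigh : ∀ a : Fin m, j ≤ (a : ℕ) → c ≤ x a) (a : Fin m) (ha : j ≤ (a : ℕ)) :
    c ≤ sortTuple x a := by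
  by_contra! hlt
  have hsub : (Finset.Iic a).image (Tuple.sort x) ⊆
      Finset.Iio a := by
    intro b hb
    simp only [Finset.mem_image, Finset.mem_Iic, Finset.mem_Iio] at hb ⊢
    obtain ⟨d, hd, rfl⟩ := hb
    have h1 : sortTuple x d ≤ sortTuple x a := sortTuple_monotone x hd
    by_contra! h2
    have h3 := hhigh (Tuple.sort x d) (ha.trans h2)
    simp only [sortTuple, Function.comp_apply] at *
    linarith
  have hcard := Finset.card_le_card hsub
  rw [Finset.card_image_of_injective _ (Tuple.sort x).injective] at hcard
  simp at hcard

end Sorting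

section Action

variable {m : ℕ}

/-- The action of a list of letters, read from left to right. -/
noncomputable def listAct (l : List (Fin m)) (x : Fin m → ℝ) : Fin m → ℝ :=
  l.foldl (fun y i => letterAct m i y) x

lemma listAct_cons (i : Fin m) (l : List (Fin m)) (x : Fin m → ℝ) :
    listAct (i :: l) x = listAct l (letterAct m i x) := rfl

lemma initialSum_shift {j : ℕ} (hj : j ≤ m) (i : Fin m) (x : Fin m → ℝ) :
    initialSum j (fun a => x a + (if a = i then (m : ℝ) else 0) - 1) =
      initialSum j x + (if (i : ℕ) < j then (m : ℝ) else 0) - j := by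
  have h1 := sum_ite_val_lt hj (1 : ℝ)
  have h2 : (∑ a : Fin m, if a = i then (if (i : ℕ) < j then (m : ℝ) else 0) else 0) =
      if (i : ℕ) < j then (m : ℝ) else 0 := by simp
  rw [mul_one] at h1
  rw [← h1, ← h2]
  unfold initialSum
  rw [← Finset.sum_add_distrib, ← Finset.sum_sub_distrib]
  refine Finset.sum_congr rfl fun a _ => ?_
  by_cases ha : a = i
  · subst ha; by_cases h : (a : ℕ) < j <;> simp [h]
  · simp only [ha, if_false]; split_ifs <;> simp

lemma sum_letterAct (i : Fin m) (x : Fin m → ℝ) : ∑ a, letterAct m i x a = ∑ a, x a := by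
  rw [letterAct, sum_comp_sortTuple (fun r => r), Finset.sum_sub_distrib,
    Finset.sum_add_distrib]
  simp

lemma sum_listAct (l : List (Fin m)) (x : Fin m → ℝ) : ∑ a, listAct l x a = ∑ a, x a := by
  induction l generalizing x with
  | nil => rfl
  | cons i l ih => rw [listAct_cons, ih, sum_letterAct]

lemma monotone_listAct (l : List (Fin m)) {x : Fin m → ℝ} (hx : Monotone x) :
    Monotone (listAct l x) := by
  induction l generalizing x with
  | nil => exact hx
  | cons i l ih => exact ih (sortTuple_monotone _)

lemma listAct_le_add (l : List (Fin m)) {x y : Fin m → ℝ} {c : ℝ} (h : ∀ a, x a ≤ y a + c)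
    (a : Fin m) : listAct l x a ≤ listAct l y a + c := by
  induction l generalizing x y with
  | nil => exact h a
  | cons i l ih => exact ih fun b => sortTuple_le_add (fun d => by linarith [h d]) b

lemma lipschitzWith_listAct_sortTuple (l : List (Fin m)) :
    LipschitzWith 1 (fun x => listAct l (sortTuple x)) := by
  refine LipschitzWith.of_dist_le_mul fun x y => ?_
  rw [NNReal.coe_one, one_mul, dist_pi_le_iff dist_nonneg]
  intro a
  have key : ∀ b, |x b - y b| ≤ dist x y := fun b => dist_le_pi_dist x y b
  have h1 := listAct_le_add l (x := sortTuple x) (y := sortTuple y) (c := dist x y)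
    (sortTuple_le_add fun b => by linarith [(abs_le.mp (key b)).2]) a
  have h2 := listAct_le_add l (x := sortTuple y) (y := sortTuple x) (c := dist x y)
    (sortTuple_le_add fun b => by linarith [(abs_le.mp (key b)).1]) a
  rw [Real.dist_eq, abs_le]
  constructor <;> linarith

lemma initialSum_listAct_le {j : ℕ} (hj : j ≤ m) (hj0 : 1 ≤ j) (l : List (Fin m))
    (x : Fin m → ℝ) :
    initialSum j (listAct l x) ≤ initialSum j x +
      (l.map fun i : Fin m => if (i : ℕ) < j then (m : ℝ) else 0).sum - j * l.length := by
  induction l generalizing x with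
  | nil => simp [listAct]
  | cons i l ih =>
    have h1 := ih (letterAct m i x)
    have h2 : initialSum j (letterAct m i x) ≤ _ := initialSum_sortTuple_le hj hj0 _
    rw [initialSum_shift hj] at h2
    rw [listAct_cons, List.map_cons, List.sum_cons, List.length_cons]
    push_cast
    linarith

lemma le_initialSum_listAct {j : ℕ} (hj : j ≤ m) (l : List (Fin m)) {A B : ℝ}
    (hAB : A + m * l.length ≤ B) {x : Fin m → ℝ}
    (hlow : ∀ a : Fin m, (a : ℕ) < j → x a ≤ A)
    (hhigh : ∀ a : Fin m, j ≤ (a : ℕ) → B ≤ x a) :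
    initialSum j x + (l.map fun i : Fin m => if (i : ℕ) < j then (m : ℝ) else 0).sum - j * l.length ≤
      initialSum j (listAct l x) := by
  induction l generalizing x A B with
  | nil => simp [listAct]
  | cons i l ih =>
    rw [List.length_cons] at hAB
    push_cast at hAB
    have hm : (0 : ℝ) ≤ m := Nat.cast_nonneg m
    have hml : (0 : ℝ) ≤ m * l.length := by positivity
    have hlow' : ∀ a : Fin m, (a : ℕ) < j →
        x a + (if a = i then (m : ℝ) else 0) - 1 ≤ A + m - 1 := by
      intro a ha
      have := hlow a ha
      split_ifs <;> linarith
    have hhigh' : ∀ a : Fin m, j ≤ (a : ℕ) →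
        B - 1 ≤ x a + (if a = i then (m : ℝ) else 0) - 1 := by
      intro a ha
      have := hhigh a ha
      split_ifs <;> linarith
    have h1 := ih (A := A + m - 1) (B := B - 1) (by linarith) (x := letterAct m i x)
      (sortTuple_le_of_low hj hlow') (le_sortTuple_of_high hhigh')
    have h2 : _ ≤ initialSum j (letterAct m i x) := initialSum_le_sortTuple hj hlow'
      (fun a ha => le_trans (by linarith) (hhigh' a ha))
    rw [initialSum_shift hj] at h2
    rw [listAct_cons, List.map_cons, List.sum_cons, List.length_cons]
    push_cast
    linarith

end Action

section Bounds

variable {m : ℕ}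

lemma initialSum_add_mul {j : ℕ} (s t : ℝ) (x y : Fin m → ℝ) :
    initialSum j (fun a => s * x a + t * y a) = s * initialSum j x + t * initialSum j y := by
  simp only [initialSum, Finset.mul_sum, ← Finset.sum_add_distrib]
  refine Finset.sum_congr rfl fun a _ => ?_
  split_ifs <;> simp

lemma continuous_initialSum (j : ℕ) : Continuous (initialSum (m := m) j) := by
  unfold initialSum
  refine continuous_finsetSum _ fun a _ => ?_
  split_ifs <;> fun_prop

lemma initialSum_le_mul {j : ℕ} (hj : j ≤ m) {x : Fin m → ℝ} {c : ℝ}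
    (h : ∀ a : Fin m, (a : ℕ) < j → x a ≤ c) : initialSum j x ≤ j * c := by
  rw [← sum_ite_val_lt hj c, initialSum]
  refine Finset.sum_le_sum fun a _ => ?_
  split_ifs with ha
  · exact h a ha
  · exact le_rfl

lemma mul_le_initialSum {j : ℕ} (hj : j ≤ m) {x : Fin m → ℝ} {c : ℝ}
    (h : ∀ a : Fin m, (a : ℕ) < j → c ≤ x a) : j * c ≤ initialSum j x := by
  rw [← sum_ite_val_lt hj c, initialSum]
  refine Finset.sum_le_sum fun a _ => ?_
  split_ifs with ha
  · exact h a ha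
  · exact le_rfl

lemma abs_initialSum_le (j : ℕ) (x : Fin m → ℝ) : |initialSum j x| ≤ ∑ a, |x a| := by
  refine (Finset.abs_sum_le_sum_abs _ _).trans (Finset.sum_le_sum fun a _ => ?_)
  split_ifs <;> simp

lemma initialSum_add_le {j : ℕ} (hj : j ≤ m) {x : Fin m → ℝ} {c : ℝ}
    (h : ∀ a : Fin m, j ≤ (a : ℕ) → c ≤ x a) :
    initialSum j x + (m - j) * c ≤ ∑ a, x a := by
  have h1 : (∑ a : Fin m, if (a : ℕ) < j then c else 0) = j * c := sum_ite_val_lt hj c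
  have h2 : (∑ a : Fin m, c) = m * c := by simp
  rw [sub_mul, ← h1, ← h2, initialSum, ← Finset.sum_sub_distrib, ← Finset.sum_add_distrib]
  refine Finset.sum_le_sum fun a _ => ?_
  split_ifs with ha
  · simp
  · linarith [h a (by omega)]

/-- A gap of a sum-zero increasing vector is bounded in terms of the initial sum below it. -/
lemma gap_le {j : ℕ} (hj0 : 1 ≤ j) (hj : j < m) {x : Fin m → ℝ} (hx : x ∈ Vm m) {M : ℝ}
    (hM0 : 0 ≤ M) (hM : -M ≤ initialSum j x) :
    x ⟨j, hj⟩ - x ⟨j - 1, by omega⟩ ≤ 2 * M := by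
  obtain ⟨hsum, hmono⟩ := hx
  have h1 := initialSum_le_mul hj.le (x := x) (c := x ⟨j - 1, by omega⟩)
    (fun a ha => hmono (Fin.mk_le_mk.mpr (by omega)))
  have h2 := initialSum_add_le hj.le (x := x) (c := x ⟨j, hj⟩)
    (fun a ha => hmono (Fin.mk_le_mk.mpr (by omega)))
  rw [hsum] at h2
  have hj0' : (1 : ℝ) ≤ j := by exact_mod_cast hj0
  have hj' : (1 : ℝ) ≤ m - j := by
    have : (j : ℝ) + 1 ≤ m := by exact_mod_cast hj
    linarith
  have h3 : -M ≤ x ⟨j - 1, by omega⟩ := by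
    by_contra! h
    nlinarith
  have h4 : x ⟨j, hj⟩ ≤ M := by
    by_contra! h
    nlinarith
  linarith

lemma abs_le_of_gap_le {x : Fin m → ℝ} (hx : x ∈ Vm m) {D : ℝ} (hD : 0 ≤ D)
    (h : ∀ (j : ℕ) (_ : 1 ≤ j) (hj : j < m), x ⟨j, hj⟩ - x ⟨j - 1, by omega⟩ ≤ D)
    (a : Fin m) : |x a| ≤ m * D := by
  obtain ⟨hsum, hmono⟩ := hx
  have hm : 0 < m := a.pos
  have hstep : ∀ (j : ℕ) (hj : j < m), x ⟨j, hj⟩ ≤ x ⟨0, hm⟩ + j * D := by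
    intro j
    induction j with
    | zero => intro hj; simp
    | succ j ih =>
      intro hj
      have h1 := ih (by omega)
      have h2 := h (j + 1) (by omega) hj
      simp only [Nat.add_sub_cancel] at h2
      push_cast
      linarith
  have hspread : ∀ b : Fin m, x b ≤ x ⟨0, hm⟩ + m * D := fun b => by
    have h1 := hstep b b.isLt
    have h2 : (b : ℝ) ≤ m := by exact_mod_cast b.isLt.le
    have h3 := mul_le_mul_of_nonneg_right h2 hD
    linarith
  have hmpos : (0 : ℝ) < m := by exact_mod_cast hm
  have hzero : x ⟨0, hm⟩ ≤ 0 := by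
    have h1 := Finset.sum_le_sum (s := Finset.univ) (f := fun _ : Fin m => x ⟨0, hm⟩) (g := x)
      (fun b _ => hmono (Fin.mk_le_mk.mpr (Nat.zero_le _)))
    rw [hsum] at h1
    simp at h1
    by_contra! h2
    nlinarith
  have hlower : 0 ≤ x ⟨0, hm⟩ + m * D := by
    have h1 := Finset.sum_le_sum (s := Finset.univ) (f := x)
      (g := fun _ : Fin m => x ⟨0, hm⟩ + m * D) (fun b _ => hspread b)
    rw [hsum] at h1
    simp only [Finset.sum_const, Finset.card_univ, Fintype.card_fin, nsmul_eq_mul] at h1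
    by_contra! h2
    nlinarith
  have h0 : x ⟨0, hm⟩ ≤ x a := hmono (Fin.mk_le_mk.mpr (Nat.zero_le _))
  rw [abs_le]
  constructor <;> linarith [hspread a]

end Bounds

section FixedPoints

variable {m n : ℕ}

lemma sum_map_ofFn_ite (w : Fin n → Fin m) (j : ℕ) :
    ((List.ofFn w).map fun i : Fin m => if (i : ℕ) < j then (m : ℝ) else 0).sum =
      m * (Finset.univ.filter (fun b => (w b : ℕ) < j)).card := by
  rw [List.map_ofFn, List.sum_ofFn]
  simp only [Function.comp_apply]
  rw [← Finset.sum_filter]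
  simp [mul_comm]

lemma initialSum_wordAct_le_of_touch {w : Fin n → Fin m} {k : ℕ}
    (hk : IsTouchPoint m n (fun b => (w b : ℕ)) k) (x : Fin m → ℝ) :
    initialSum k (wordAct w x) ≤ initialSum k x := by
  obtain ⟨hk0, hkm, hcard⟩ := hk
  have h := initialSum_listAct_le hkm.le hk0 (List.ofFn w) x
  rw [sum_map_ofFn_ite, List.length_ofFn] at h
  have hcard' : (m : ℝ) * (Finset.univ.filter (fun b => (w b : ℕ) < k)).card = k * n := by
    exact_mod_cast hcard
  rw [hcard', add_sub_cancel_right] at h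
  exact h

lemma le_initialSum_wordAct {w : Fin n → Fin m} (hw : IsParkingWord m n (fun b => (w b : ℕ)))
    {x : Fin m → ℝ} (hx : Monotone x) {j : ℕ} (hj0 : 1 ≤ j) (hj : j < m)
    (hgap : x ⟨j - 1, by omega⟩ + m * n ≤ x ⟨j, hj⟩) :
    initialSum j x ≤ initialSum j (wordAct w x) := by
  have h := le_initialSum_listAct hj.le (List.ofFn w) (x := x) (A := x ⟨j - 1, by omega⟩)
    (B := x ⟨j, hj⟩) (by simpa using hgap)
    (fun a ha => hx (Fin.mk_le_mk.mpr (by omega)))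
    (fun a ha => hx (Fin.mk_le_mk.mpr (by omega)))
  rw [sum_map_ofFn_ite, List.length_ofFn] at h
  have hcard : (j : ℝ) * n ≤ m * (Finset.univ.filter (fun b => (w b : ℕ) < j)).card := by
    exact_mod_cast hw.2 j hj0 hj.le
  refine le_trans ?_ h
  linarith

/-- The contraction obtained by averaging the action of `w` with a base point has a fixed point,
which lies in `Vm`. -/
lemma exists_averaged_fixedPoint (w : Fin n → Fin m) {x₀ : Fin m → ℝ} (hx₀ : x₀ ∈ Vm m)
    {t : ℝ} (ht0 : 0 < t) (ht1 : t < 1) :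
    ∃ x ∈ Vm m, x = fun a => (1 - t) * wordAct w x a + t * x₀ a := by
  let F : (Fin m → ℝ) → Fin m → ℝ := fun x => wordAct w (sortTuple x)
  have hF : LipschitzWith 1 F := lipschitzWith_listAct_sortTuple (List.ofFn w)
  let G : (Fin m → ℝ) → Fin m → ℝ := fun x a => (1 - t) * F x a + t * x₀ a
  have hG : ContractingWith (Real.toNNReal (1 - t)) G := by
    refine ⟨?_, LipschitzWith.of_dist_le_mul fun x y => ?_⟩
    · simpa using ht0
    · have h1 : (0 : ℝ) ≤ 1 - t := by linarith
      rw [Real.coe_toNNReal _ h1, dist_pi_le_iff (by positivity)]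
      intro a
      have h2 : dist (F x a) (F y a) ≤ dist x y :=
        (dist_le_pi_dist _ _ a).trans (by simpa using hF.dist_le_mul x y)
      rw [Real.dist_eq] at h2 ⊢
      have h3 : G x a - G y a = (1 - t) * (F x a - F y a) := by simp only [G]; ring
      rw [h3, abs_mul, abs_of_nonneg h1]
      exact mul_le_mul_of_nonneg_left h2 h1
  obtain ⟨x, hx⟩ : ∃ x, G x = x := ⟨_, hG.fixedPoint_isFixedPt⟩
  have hmono : Monotone x := by
    rw [← hx]
    intro a b hab
    have h1 : F x a ≤ F x b := monotone_listAct (List.ofFn w) (sortTuple_monotone x) hab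
    have h2 := hx₀.2 hab
    have h3 := mul_le_mul_of_nonneg_left h1 (by linarith : (0 : ℝ) ≤ 1 - t)
    have h4 := mul_le_mul_of_nonneg_left h2 ht0.le
    exact add_le_add h3 h4
  have hFx : F x = wordAct w x := by simp only [F, sortTuple_eq_self hmono]
  have hsum : ∑ a, x a = 0 := by
    have h1 : ∑ a, x a = (1 - t) * ∑ a, x a + t * ∑ a, x₀ a := by
      conv_lhs => rw [← hx]
      simp only [G, Finset.sum_add_distrib, ← Finset.mul_sum, hFx]
      rw [show wordAct w x = listAct (List.ofFn w) x from rfl, sum_listAct]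
    rw [hx₀.1] at h1
    have h2 : t * ∑ a, x a = 0 := by linarith
    exact (mul_eq_zero.mp h2).resolve_left ht0.ne'
  exact ⟨x, ⟨hsum, hmono⟩, by rw [← hFx]; exact hx.symm⟩

/-- A parking word has a fixed point whose initial sum at a given touch point does not exceed
that of a prescribed point. -/
lemma exists_fixedPoint_initialSum_le {w : Fin n → Fin m}
    (hw : IsParkingWord m n (fun b => (w b : ℕ))) {k : ℕ}
    (hk : IsTouchPoint m n (fun b => (w b : ℕ)) k) {x₀ : Fin m → ℝ} (hx₀ : x₀ ∈ Vm m) :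
    ∃ x ∈ Vm m, wordAct w x = x ∧ initialSum k x ≤ initialSum k x₀ := by
  set M : ℝ := ∑ a, |x₀ a|
  have hM0 : 0 ≤ M := Finset.sum_nonneg fun a _ => abs_nonneg _
  set D : ℝ := m * n + 2 * M
  have hD0 : 0 ≤ D := by positivity
  let F : (Fin m → ℝ) → Fin m → ℝ := fun x => wordAct w (sortTuple x)
  have hF : LipschitzWith 1 F := lipschitzWith_listAct_sortTuple (List.ofFn w)
  let K : Set (Fin m → ℝ) :=
    Metric.closedBall 0 (m * D) ∩ (Vm m ∩ {x | initialSum k x ≤ initialSum k x₀})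
  have hKc : IsCompact K := by
    refine (isCompact_closedBall _ _).inter_right (IsClosed.inter ?_ ?_)
    · refine IsClosed.inter (isClosed_eq (by fun_prop) continuous_const) ?_
      exact isClosed_monotone
    · exact isClosed_le (continuous_initialSum k) continuous_const
  have happrox : ∀ t : ℝ, 0 < t → t < 1 →
      ∃ x ∈ K, dist (F x) x ≤ t * (m * D + dist (F 0) 0 + ‖x₀‖) := by
    intro t ht0 ht1
    obtain ⟨x, hxV, hx⟩ := exists_averaged_fixedPoint w hx₀ ht0 ht1
    have hinit : ∀ j, initialSum j x =
        (1 - t) * initialSum j (wordAct w x) + t * initialSum j x₀ := fun j => by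
      conv_lhs => rw [hx]
      exact initialSum_add_mul _ _ _ _
    have habs : ∀ a, |x a| ≤ m * D := by
      refine abs_le_of_gap_le hxV hD0 fun j hj0 hj => ?_
      by_cases hgap : x ⟨j - 1, by omega⟩ + m * n ≤ x ⟨j, hj⟩
      · have h1 := le_initialSum_wordAct hw hxV.2 hj0 hj hgap
        have h2 := hinit j
        have h3 : initialSum j x₀ ≤ initialSum j x := by
          have h4 := mul_le_mul_of_nonneg_left h1 (by linarith : (0 : ℝ) ≤ 1 - t)
          have h5 : t * initialSum j x₀ ≤ t * initialSum j x := by linarith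
          exact le_of_mul_le_mul_left h5 ht0
        have h4 := gap_le hj0 hj hxV hM0
          (h3.trans' (abs_le.mp (abs_initialSum_le j x₀)).1)
        have : (0 : ℝ) ≤ m * n := by positivity
        linarith
      · linarith
    have hnorm : ‖x‖ ≤ m * D := (pi_norm_le_iff_of_nonneg (by positivity)).mpr habs
    have hle : initialSum k x ≤ initialSum k x₀ := by
      have h1 := initialSum_wordAct_le_of_touch hk x
      have h2 := hinit k
      have h4 := mul_le_mul_of_nonneg_left h1 (by linarith : (0 : ℝ) ≤ 1 - t)
      have h5 : t * initialSum k x ≤ t * initialSum k x₀ := by linarith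
      exact le_of_mul_le_mul_left h5 ht0
    refine ⟨x, ⟨by simpa using hnorm, hxV, hle⟩, ?_⟩
    have hFx : F x = wordAct w x := by simp only [F, sortTuple_eq_self hxV.2]
    have hdiff : F x - x = t • (F x - x₀) := by
      funext a
      have := congrFun hx a
      rw [← hFx] at this
      simp only [Pi.sub_apply, Pi.smul_apply, smul_eq_mul]
      linarith
    rw [dist_eq_norm, hdiff, norm_smul, Real.norm_of_nonneg ht0.le]
    refine mul_le_mul_of_nonneg_left ?_ ht0.le
    have h1 := hF.dist_le_mul x 0
    simp only [NNReal.coe_one, one_mul, dist_zero_right] at h1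
    have h2 := norm_sub_le (F x) x₀
    have h3 := dist_triangle (F x) (F 0) 0
    rw [dist_zero_right] at h3
    linarith
  obtain ⟨x₁, hx₁, -⟩ := happrox (1 / 2) (by norm_num) (by norm_num)
  obtain ⟨x, hxK, hmin⟩ := hKc.exists_isMinOn ⟨x₁, hx₁⟩
    (f := fun x => dist (F x) x) (by have := hF.continuous; fun_prop)
  have hfix : F x = x := by
    by_contra hne
    have hpos : 0 < dist (F x) x := dist_pos.mpr hne
    set E : ℝ := m * D + dist (F 0) 0 + ‖x₀‖
    have hE0 : 0 ≤ E := by positivity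
    set δ : ℝ := dist (F x) x
    have ht0 : 0 < δ / (δ + E + 1) := by positivity
    have ht1 : δ / (δ + E + 1) < 1 := by rw [div_lt_one (by positivity)]; linarith
    obtain ⟨y, hyK, hy⟩ := happrox _ ht0 ht1
    have h1 : δ ≤ dist (F y) y := hmin hyK
    have h2 : δ / (δ + E + 1) * E < δ := by
      rw [div_mul_eq_mul_div, div_lt_iff₀ (by positivity)]
      nlinarith
    linarith
  refine ⟨x, hxK.2.1, ?_, hxK.2.2⟩
  simpa only [F, sortTuple_eq_self hxK.2.1.2] using hfix

/-- There are points of `Vm` with arbitrarily negative initial sums. -/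
lemma exists_mem_Vm_initialSum_le {k : ℕ} (hk0 : 1 ≤ k) (hk : k < m) {R : ℝ} (hR : 0 ≤ R) :
    ∃ x ∈ Vm m, initialSum k x ≤ -R := by
  have hk0' : (1 : ℝ) ≤ k := by exact_mod_cast hk0
  have hk' : (1 : ℝ) ≤ m - k := by
    have : (k : ℝ) + 1 ≤ m := by exact_mod_cast hk
    linarith
  refine ⟨fun a => k * R - if (a : ℕ) < k then m * R else 0, ⟨?_, ?_⟩, ?_⟩
  · rw [Finset.sum_sub_distrib, sum_ite_val_lt hk.le]
    simp
    ring
  · intro a b hab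
    have hab' : (a : ℕ) ≤ b := hab
    have : 0 ≤ m * R := by positivity
    dsimp only
    split_ifs <;> first | omega | linarith
  · refine (initialSum_le_mul hk.le (c := k * R - m * R) fun a ha => by simp [ha]).trans ?_
    nlinarith [mul_nonneg (by linarith : (0 : ℝ) ≤ k - 1) (by linarith : (0 : ℝ) ≤ m - k - 1),
      mul_le_mul_of_nonneg_right (show (1 : ℝ) ≤ k * (m - k) by nlinarith) hR]

lemma sq_le_normSq {x : Fin m → ℝ} {a b : Fin m} (hab : a < b) : (x b - x a) ^ 2 ≤ normSq x := by
  have hnn : ∀ i j : Fin m, 0 ≤ if i < j then (x j - x i) ^ 2 else 0 := fun i j => by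
    split_ifs <;> positivity
  have h1 := Finset.single_le_sum (f := fun j => if a < j then (x j - x a) ^ 2 else 0)
    (fun j _ => hnn a j) (Finset.mem_univ b)
  have h2 := Finset.single_le_sum (f := fun i => ∑ j, if i < j then (x j - x i) ^ 2 else 0)
    (fun i _ => Finset.sum_nonneg fun j _ => hnn i j) (Finset.mem_univ a)
  simp only [hab, if_true] at h1
  exact h1.trans h2

lemma lt_normSq_of_initialSum_le {k : ℕ} (hk0 : 1 ≤ k) (hk : k < m) {x : Fin m → ℝ}
    (hx : x ∈ Vm m) {C : ℝ} (h : initialSum k x ≤ -(m * (|C| + 1))) : C < normSq x := by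
  obtain ⟨hsum, hmono⟩ := hx
  have hk0' : (1 : ℝ) ≤ k := by exact_mod_cast hk0
  have hk' : (k : ℝ) + 1 ≤ m := by exact_mod_cast hk
  have hC := abs_nonneg C
  have h1 := mul_le_initialSum hk.le (x := x) (c := x ⟨0, by omega⟩)
    (fun a _ => hmono (Fin.mk_le_mk.mpr (Nat.zero_le _)))
  have h2 := initialSum_le_mul le_rfl (x := x) (c := x ⟨m - 1, by omega⟩)
    (fun a _ => hmono (Fin.mk_le_mk.mpr (by omega)))
  have h3 : initialSum m x = 0 := by simpa [initialSum] using hsum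
  have h4 : x ⟨0, by omega⟩ ≤ -(|C| + 1) := by
    by_contra! hlt
    nlinarith
  have h5 : 0 ≤ x ⟨m - 1, by omega⟩ := by
    by_contra! hlt
    nlinarith
  have h6 := sq_le_normSq (x := x) (a := ⟨0, by omega⟩) (b := ⟨m - 1, by omega⟩)
    (Fin.mk_lt_mk.mpr (by omega))
  nlinarith [le_abs_self C]

end FixedPoints

/-- An (m,n)-parking word with `gcd(m,n) > 1` having a touch point has infinitely
many fixed points on `V^m`, including fixed points of arbitrarily large norm. -/
theorem parking_word_touch_point_infinitely_many_fixed_points (m n : ℕ)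
    (hd : 1 < Nat.gcd m n) (w : Fin n → Fin m)
    (hw : IsParkingWord m n (fun j => (w j : ℕ)))
    (htouch : ∃ i : ℕ, IsTouchPoint m n (fun j => (w j : ℕ)) i) :
    {x : Fin m → ℝ | x ∈ Vm m ∧ wordAct w x = x}.Infinite ∧
    (∀ C : ℝ, ∃ x : Fin m → ℝ, x ∈ Vm m ∧ wordAct w x = x ∧ C < normSq x) := by
  obtain ⟨k, hk⟩ := htouch
  have hlarge : ∀ C : ℝ, ∃ x : Fin m → ℝ, x ∈ Vm m ∧ wordAct w x = x ∧ C < normSq x := by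
    intro C
    obtain ⟨x₀, hx₀, hx₀R⟩ := exists_mem_Vm_initialSum_le hk.1 hk.2.1
      (R := m * (|C| + 1)) (by positivity)
    obtain ⟨x, hxV, hfix, hle⟩ := exists_fixedPoint_initialSum_le hw hk hx₀
    exact ⟨x, hxV, hfix, lt_normSq_of_initialSum_le hk.1 hk.2.1 hxV (hle.trans hx₀R)⟩
  refine ⟨fun hfin => ?_, hlarge⟩
  obtain ⟨C, hC⟩ := (hfin.image normSq).bddAbove
  obtain ⟨x, hxV, hfix, hlt⟩ := hlarge C
  exact hlt.not_ge (hC ⟨x, ⟨hxV, hfix⟩, rfl⟩)
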